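/- Let n ≥ 1, let 0 ≤ k ≤ n be an integer, let m be a positive integer, and let a ∈ ½ℤ with a ≥ 0. Then, as an identity of rational functions in ℚ(x_1^{1/2},…,x_n^{1/2}), the sum of the intermediate symplectic characters sp^{(k,n−k)}_{λ+(a^n)}(x_1,…,x_k | x_{k+1},…,x_n) over all partitions λ ∈ Par((m^n)) equals so^B_{((m/2)^n)}(x_1,…,x_n) · sp_{((m/2+a)^k)}(x_1,…,x_k) · (x_{k+1}⋯x_n)^{m/2+a}. -/

import Mathlib

open Matrix BigOperators
open scoped Classical

noncomputable section

/-- The field `ℚ(t_1, …, t_n)` of rational functions in `n` indeterminates over `ℚ`. -/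
abbrev FF (n : ℕ) : Type := FractionRing (MvPolynomial (Fin n) ℚ)

/-- The `i`-th indeterminate, viewed as an element of `FF n`. -/
def gen (n : ℕ) (i : Fin n) : FF n :=
  algebraMap (MvPolynomial (Fin n) ℚ) (FF n) (MvPolynomial.X i)

variable {F : Type*} [Field F]

/-- Symplectic character `sp_λ(x_1, …, x_N)`, in "doubled" form: `z i` represents
`x_i^{1/2}` and `μ i` represents `2·λ_i` (so half-integer weights are allowed). -/
def spD {N : ℕ} (z : Fin N → F) (μ : Fin N → ℤ) : F :=
  Matrix.det (Matrix.of fun i j : Fin N =>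
      z j ^ (μ i + 2 * ((N : ℤ) - (i : ℕ))) - z j ^ (-(μ i + 2 * ((N : ℤ) - (i : ℕ))))) /
  Matrix.det (Matrix.of fun i j : Fin N =>
      z j ^ (2 * ((N : ℤ) - (i : ℕ))) - z j ^ (-(2 * ((N : ℤ) - (i : ℕ)))))

/-- Odd orthogonal character `so^B_λ(x_1, …, x_N)`, in "doubled" form: `z i` represents
`x_i^{1/2}` and `μ i` represents `2·λ_i`. -/
def soBD {N : ℕ} (z : Fin N → F) (μ : Fin N → ℤ) : F :=
  Matrix.det (Matrix.of fun i j : Fin N =>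
      z j ^ (μ i + 2 * ((N : ℤ) - (i : ℕ)) - 1) -
        z j ^ (-(μ i + 2 * ((N : ℤ) - (i : ℕ)) - 1))) /
  Matrix.det (Matrix.of fun i j : Fin N =>
      z j ^ (2 * ((N : ℤ) - (i : ℕ)) - 1) - z j ^ (-(2 * ((N : ℤ) - (i : ℕ)) - 1)))

/-- Even orthogonal character `so^D_λ(x_1, …, x_N)`, in "doubled" form: `z i` represents
`x_i^{1/2}` and `μ i` represents `2·λ_i`; the factor is `2` if `λ_N > 0` and `1` otherwise. -/
def soDD {N : ℕ} (z : Fin N → F) (μ : Fin N → ℤ) : F :=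
  (if h : 0 < N then (if 0 < μ ⟨N - 1, Nat.sub_lt h Nat.one_pos⟩ then (2 : F) else 1) else 1) *
  (Matrix.det (Matrix.of fun i j : Fin N =>
      z j ^ (μ i + 2 * ((N : ℤ) - 1 - (i : ℕ))) +
        z j ^ (-(μ i + 2 * ((N : ℤ) - 1 - (i : ℕ))))) /
   Matrix.det (Matrix.of fun i j : Fin N =>
      z j ^ (2 * ((N : ℤ) - 1 - (i : ℕ))) + z j ^ (-(2 * ((N : ℤ) - 1 - (i : ℕ))))))

/-- The matrix `Ā_λ` of the bialternant formula for the intermediate symplectic character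
`sp^{(k, N-k)}`, in "doubled" form: `z i` represents `x_i^{1/2}`, `μ i` represents `2·λ_i`. -/
def interMatD {N : ℕ} (k : ℕ) (z : Fin N → F) (μ : Fin N → ℤ) : Matrix (Fin N) (Fin N) F :=
  Matrix.of fun i j : Fin N =>
    if (j : ℕ) < k then
      z j ^ (μ i + 2 * ((k : ℤ) - (i : ℕ))) /
          ∏ l ∈ Finset.univ.filter (fun l : Fin N => k ≤ (l : ℕ)), (1 - (z j ^ 2)⁻¹ * z l ^ 2) -
        z j ^ (-(μ i + 2 * ((k : ℤ) - (i : ℕ)))) /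
          ∏ l ∈ Finset.univ.filter (fun l : Fin N => k ≤ (l : ℕ)), (1 - z j ^ 2 * z l ^ 2)
    else z j ^ (μ i + 2 * ((N : ℤ) - 1 - (i : ℕ)))

/-- Intermediate symplectic character `sp^{(k, N-k)}_λ(x_1, …, x_k | x_{k+1}, …, x_N)`, in
"doubled" form: `z i` represents `x_i^{1/2}` and `μ i` represents `2·λ_i`. -/
def spInterD {N : ℕ} (k : ℕ) (z : Fin N → F) (μ : Fin N → ℤ) : F :=
  (interMatD k z μ).det / (interMatD k z fun _ => 0).det


/-- The partitions in a rectangle: weakly decreasing sequences of naturals below `M`. -/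
def boundedPartitions (n M : ℕ) : Finset (Fin n → ℕ) :=
  (Fintype.piFinset fun _ => Finset.range M).filter Antitone

theorem mem_boundedPartitions {n M : ℕ} {p : Fin n → ℕ} :
    p ∈ boundedPartitions n M ↔ (∀ i, p i < M) ∧ Antitone p := by
  simp [boundedPartitions]

theorem sum_boundedPartitions_eq_sum_fin (n M : ℕ) (f : (Fin n → ℕ) → F) :
    ∑ p ∈ boundedPartitions n M, f p =
      ∑ lam ∈ Finset.univ.filter (fun lam : Fin n → Fin M => Antitone fun i => (lam i : ℕ)),
        f fun i => (lam i : ℕ) := by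
  symm
  refine Finset.sum_bij' (fun lam _ i => (lam i : ℕ))
    (fun p hp i => ⟨p i, (mem_boundedPartitions.1 hp).1 i⟩) ?_ ?_ ?_ ?_ ?_
  · intro lam h
    simpa [mem_boundedPartitions] using h
  · intro p hp
    simpa using (mem_boundedPartitions.1 hp).2
  · intros; rfl
  · intros; rfl
  · intros; rfl

theorem antitone_cons_iff {n : ℕ} {a : ℕ} {p : Fin n → ℕ} :
    Antitone (Fin.cons a p : Fin (n + 1) → ℕ) ↔ (∀ i, p i ≤ a) ∧ Antitone p := by
  constructor
  · intro h
    refine ⟨fun i => by simpa using h (Fin.zero_le i.succ), fun i j hij => ?_⟩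
    simpa using h (Fin.succ_le_succ_iff.2 hij)
  · rintro ⟨h1, h2⟩ i j
    refine Fin.cases ?_ (fun i => ?_) i <;> refine Fin.cases ?_ (fun j => ?_) j
    · simp
    · simp [h1]
    · intro h
      simp at h
    · intro h
      simpa using h2 (Fin.succ_le_succ_iff.1 h)

/-- Splitting off the partitions whose first part is maximal. -/
theorem sum_boundedPartitions_succ (n M : ℕ) (f : (Fin (n + 1) → ℕ) → F) :
    ∑ p ∈ boundedPartitions (n + 1) (M + 1), f p =
      ∑ p ∈ boundedPartitions (n + 1) M, f p +
        ∑ p ∈ boundedPartitions n (M + 1), f (Fin.cons M p) := by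
  rw [← Finset.sum_filter_add_sum_filter_not (boundedPartitions (n + 1) (M + 1))
    (fun p => p 0 < M)]
  congr 1
  · refine Finset.sum_congr ?_ fun _ _ => rfl
    ext p
    simp only [Finset.mem_filter, mem_boundedPartitions]
    constructor
    · rintro ⟨⟨_, h⟩, h0⟩
      exact ⟨fun i => (h (Fin.zero_le i)).trans_lt h0, h⟩
    · rintro ⟨h1, h2⟩
      exact ⟨⟨fun i => (h1 i).trans (Nat.lt_succ_self M), h2⟩, h1 0⟩
  · symm
    refine Finset.sum_bij' (fun p _ => Fin.cons M p) (fun p _ => Fin.tail p) ?_ ?_ ?_ ?_ ?_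
    · intro p hp
      rw [mem_boundedPartitions] at hp
      simp only [Finset.mem_filter, mem_boundedPartitions, antitone_cons_iff]
      refine ⟨⟨Fin.cases (by simp) (by simpa using hp.1), fun i => Nat.lt_succ_iff.1 (hp.1 i),
        hp.2⟩, by simp⟩
    · intro p hp
      simp only [Finset.mem_filter, mem_boundedPartitions] at hp ⊢
      exact ⟨fun i => hp.1.1 _, fun i j hij => hp.1.2 (Fin.succ_le_succ_iff.2 hij)⟩
    · intro p _
      simp
    · intro p hp
      simp only [Finset.mem_filter, mem_boundedPartitions] at hp
      have : M = p 0 := by have := hp.1.1 0; omega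
      rw [this, Fin.cons_self_tail]
    · intros; rfl

/-- The product of `f i j` over all pairs `i < j`. -/
def pairProd {n : ℕ} (f : Fin n → Fin n → F) : F := ∏ i, ∏ j ∈ Finset.Ioi i, f i j

theorem pairProd_eq_prod_ite {n : ℕ} (f : Fin n → Fin n → F) :
    pairProd f = ∏ i, ∏ j, if i < j then f i j else 1 := by
  unfold pairProd
  refine Finset.prod_congr rfl fun i _ => ?_
  rw [← Finset.prod_filter]
  congr 1
  ext j
  simp

theorem pairProd_congr {n : ℕ} {f g : Fin n → Fin n → F} (h : ∀ i j, i < j → f i j = g i j) :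
    pairProd f = pairProd g :=
  Finset.prod_congr rfl fun i _ => Finset.prod_congr rfl fun j hj => h i j (Finset.mem_Ioi.1 hj)

theorem pairProd_mul {n : ℕ} (f g : Fin n → Fin n → F) :
    pairProd (fun i j => f i j * g i j) = pairProd f * pairProd g := by
  simp only [pairProd, Finset.prod_mul_distrib]

theorem pairProd_ne_zero {n : ℕ} {f : Fin n → Fin n → F} (h : ∀ i j, i < j → f i j ≠ 0) :
    pairProd f ≠ 0 :=
  Finset.prod_ne_zero_iff.2 fun i _ => Finset.prod_ne_zero_iff.2 fun j hj =>
    h i j (Finset.mem_Ioi.1 hj)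

theorem pairProd_succAbove {n : ℕ} (f : Fin (n + 1) → Fin (n + 1) → F)
    (hf : ∀ i j, f i j = -f j i) (j : Fin (n + 1)) :
    pairProd f = (-1) ^ (j : ℕ) * (∏ i, f j (j.succAbove i)) *
      pairProd fun a b => f (j.succAbove a) (j.succAbove b) := by
  have hsign : (∏ i : Fin n, if j.succAbove i < j then (-1 : F) else 1) = (-1) ^ (j : ℕ) := by
    simp only [Fin.succAbove_lt_iff_castSucc_lt]
    rw [← Finset.prod_filter, Finset.prod_const]
    congr 1
    have : (Finset.univ.filter fun i : Fin n => i.castSucc < j).map Fin.valEmbedding =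
        Finset.range j := by
      ext a
      simp only [Finset.mem_map, Finset.mem_filter, Finset.mem_univ, true_and, Finset.mem_range,
        Fin.valEmbedding_apply, Fin.lt_def, Fin.val_castSucc]
      constructor
      · rintro ⟨i, hi, rfl⟩
        exact hi
      · intro h
        exact ⟨⟨a, by omega⟩, h, rfl⟩
    rw [← Finset.card_map Fin.valEmbedding, this, Finset.card_range]
  rw [pairProd_eq_prod_ite, pairProd_eq_prod_ite, Fin.prod_univ_succAbove _ j, ← hsign]
  simp only [Fin.prod_univ_succAbove _ j, lt_irrefl, if_false, one_mul,
    Fin.succAbove_lt_succAbove_iff, Finset.prod_mul_distrib]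
  rw [← mul_assoc]
  congr 1
  rw [← Finset.prod_mul_distrib, ← Finset.prod_mul_distrib]
  refine Finset.prod_congr rfl fun i _ => ?_
  rcases lt_or_gt_of_ne (Fin.succAbove_ne j i) with h | h
  · simp [h, h.not_gt, hf j (j.succAbove i)]
  · simp [h, h.not_gt]

theorem pairProd_sub_add {k r : ℕ} (y : Fin (k + r) → F) :
    pairProd (fun i j => y i - y j) =
      pairProd (fun i j => y (Fin.castAdd r i) - y (Fin.castAdd r j)) *
        (∏ i, ∏ l, (y (Fin.castAdd r i) - y (Fin.natAdd k l))) *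
        pairProd (fun i j => y (Fin.natAdd k i) - y (Fin.natAdd k j)) := by
  simp only [pairProd_eq_prod_ite, Fin.prod_univ_add]
  have h1 : ∀ (i : Fin k) (j : Fin r), Fin.castAdd r i < Fin.natAdd k j := fun i j => by
    simp only [Fin.lt_def, Fin.val_castAdd, Fin.val_natAdd]; omega
  have h2 : ∀ (i : Fin k) (j : Fin r), ¬ Fin.natAdd k j < Fin.castAdd r i := fun i j =>
    (h1 i j).not_gt
  have h3 : ∀ i j : Fin k, Fin.castAdd r i < Fin.castAdd r j ↔ i < j := fun i j => Iff.rfl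
  simp [h1, h2, h3, Finset.prod_mul_distrib]

/-- A partial fraction identity, obtained by interpolating `∏ (y_i X - 1)` at the `y_i` and `-1`. -/
theorem sum_prod_mul_sub_one_div {ι : Type*} [DecidableEq ι] (s : Finset ι) (y : ι → F) (hy : Set.InjOn y s)
    (h1 : ∀ i ∈ s, y i ≠ -1) :
    ∑ j ∈ s, (y j - 1) * ∏ i ∈ s.erase j, ((y i * y j - 1) / (y j - y i)) = ∏ i ∈ s, y i - 1 := by
  set P : Polynomial F := ∏ i ∈ s, (Polynomial.C (y i) * Polynomial.X - 1) with hP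
  set v : Option ι → F := fun o => o.elim (-1) y
  have hfac : ∀ i ∈ s, (Polynomial.C (y i) * Polynomial.X - 1).natDegree ≤ 1 := fun i _ => by
    compute_degree
  have hdeg : P.natDegree ≤ s.card := by
    simpa using (Polynomial.natDegree_prod_le s _).trans (Finset.sum_le_sum hfac)
  have hcoeff : P.coeff s.card = ∏ i ∈ s, y i := by
    have := Polynomial.coeff_prod_of_natDegree_le s _ 1 hfac
    rw [mul_one] at this
    rw [hP, this]
    exact Finset.prod_congr rfl fun i _ => by simp [Polynomial.coeff_one]
  have hinj : Set.InjOn v (Finset.insertNone s) := by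
    rintro (_ | a) ha (_ | b) hb hab
    · rfl
    · exact absurd hab.symm (h1 b (by simpa using hb))
    · exact absurd hab (h1 a (by simpa using ha))
    · exact congrArg some (hy (by simpa using ha) (by simpa using hb) hab)
  have key := Lagrange.coeff_eq_sum hinj (P := P) (by
    rw [Finset.card_insertNone]
    exact (Polynomial.degree_le_natDegree).trans_lt (by exact_mod_cast Nat.lt_succ_of_le hdeg))
  rw [Finset.card_insertNone, Nat.add_sub_cancel, hcoeff, Finset.sum_insertNone] at key
  have hnone : (Finset.insertNone s).erase none = s.map Function.Embedding.some := by
    ext (_ | a) <;> simp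
  have hsome : ∀ j, (Finset.insertNone s).erase (some j) = Finset.insertNone (s.erase j) := by
    intro j
    ext (_ | a) <;> simp
  have hfirst : Polynomial.eval (v none) P /
      ∏ j ∈ (Finset.insertNone s).erase none, (v none - v j) = 1 := by
    rw [hnone, Finset.prod_map, hP, Polynomial.eval_prod, ← Finset.prod_div_distrib]
    refine Finset.prod_eq_one fun i hi => ?_
    have : (-1 : F) - y i ≠ 0 := fun h => h1 i hi (by linear_combination -h)
    simp only [v, Polynomial.eval_sub, Polynomial.eval_mul, Polynomial.eval_C, Polynomial.eval_X,
      Polynomial.eval_one, Option.elim, Function.Embedding.some_apply]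
    rw [div_eq_one_iff_eq this]
    ring
  rw [hfirst] at key
  rw [key, add_sub_cancel_left]
  refine Finset.sum_congr rfl fun j hj => ?_
  rw [hsome, Finset.prod_insertNone, hP, Polynomial.eval_prod, ← Finset.mul_prod_erase s _ hj,
    Finset.prod_div_distrib]
  have hj1 : y j - -1 ≠ 0 := sub_ne_zero.2 (h1 j hj)
  have hj2 : ∏ i ∈ s.erase j, (y j - y i) ≠ 0 := Finset.prod_ne_zero_iff.2 fun i hi h =>
    (Finset.mem_erase.1 hi).1 (hy (Finset.mem_erase.1 hi).2 hj (sub_eq_zero.1 h).symm)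
  simp only [v, Polynomial.eval_sub, Polynomial.eval_mul, Polynomial.eval_C, Polynomial.eval_X,
      Polynomial.eval_one, Option.elim]
  field_simp
  ring

/-- Invert the variables `z j` for which `ε j = false`. -/
def invertAt {n : ℕ} (z : Fin n → F) (ε : Fin n → Bool) : Fin n → F :=
  fun j => if ε j then z j else (z j)⁻¹

/-- The sign attached to inverting a variable. -/
def boolSign (F : Type*) [Field F] (b : Bool) : F := if b then 1 else -1

/-- Genericity of square roots of variables: no denominator of the Weyl type vanishes. -/
structure IsGeneric {n : ℕ} (z : Fin n → F) : Prop where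
  ne_zero : ∀ i, z i ≠ 0
  mul_ne_one : ∀ i j, z i ^ 2 * z j ^ 2 ≠ 1
  sq_ne_sq : ∀ i j, i ≠ j → z i ^ 2 ≠ z j ^ 2

theorem IsGeneric.sq_ne_one {n : ℕ} {z : Fin n → F} (hz : IsGeneric z) (i : Fin n) :
    z i ^ 2 ≠ 1 := fun h => hz.mul_ne_one i i (by rw [h, mul_one])

theorem IsGeneric.sq_ne_neg_one {n : ℕ} {z : Fin n → F} (hz : IsGeneric z) (i : Fin n) :
    z i ^ 2 ≠ -1 := fun h => hz.mul_ne_one i i (by rw [h]; ring)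

theorem IsGeneric.comp {n n' : ℕ} {z : Fin n → F} (hz : IsGeneric z) {f : Fin n' → Fin n}
    (hf : Function.Injective f) : IsGeneric fun i => z (f i) :=
  ⟨fun _ => hz.ne_zero _, fun _ _ => hz.mul_ne_one _ _, fun _ _ h =>
    hz.sq_ne_sq _ _ (hf.ne h)⟩

theorem IsGeneric.invertAt {n : ℕ} {z : Fin n → F} (hz : IsGeneric z) (ε : Fin n → Bool) :
    IsGeneric (invertAt z ε) := by
  have h0 := hz.ne_zero
  refine ⟨fun i => ?_, fun i j => ?_, fun i j hij => ?_⟩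
  · have := h0 i
    unfold _root_.invertAt
    split_ifs <;> simp [this]
  · have hi := h0 i
    have hj := h0 j
    by_cases hij : i = j
    · subst hij
      have := hz.mul_ne_one i i
      unfold _root_.invertAt
      split_ifs
      · exact this
      · rw [inv_pow, ← mul_inv, Ne, inv_eq_one]
        exact this
    · have h1 := hz.mul_ne_one i j
      have h2 := hz.sq_ne_sq i j hij
      unfold _root_.invertAt
      split_ifs
      · exact h1
      · intro h
        apply h2
        field_simp at h
        exact h
      · intro h
        apply h2
        field_simp at h
        exact h.symm
      · rw [inv_pow, inv_pow, ← mul_inv, Ne, inv_eq_one]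
        exact h1
  · have hi := h0 i
    have hj := h0 j
    have h1 := hz.mul_ne_one i j
    have h2 := hz.sq_ne_sq i j hij
    unfold _root_.invertAt
    split_ifs
    · exact h2
    · intro h
      apply h1
      field_simp at h
      exact h
    · intro h
      apply h1
      field_simp at h
      rw [← h]
    · rw [inv_pow, inv_pow, Ne, _root_.inv_inj]
      exact h2

theorem det_zpow {n : ℕ} {w : Fin n → F} (hw : ∀ i, w i ≠ 0) (c : ℤ) :
    Matrix.det (Matrix.of fun i j : Fin n => w j ^ (c + 2 * ((n : ℤ) - 1 - (i : ℕ)))) =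
      (∏ j, w j ^ c) * pairProd fun i j => w i ^ 2 - w j ^ 2 := by
  have h : (Matrix.of fun i j : Fin n => w j ^ (c + 2 * ((n : ℤ) - 1 - (i : ℕ)))) =
      Matrix.of fun i j => w j ^ c *
        (Matrix.projVandermonde (fun _ => (1 : F)) fun j => w j ^ 2)ᵀ i j := by
    ext i j
    rw [Matrix.of_apply, Matrix.of_apply, Matrix.transpose_apply, Matrix.projVandermonde_apply,
      one_pow, one_mul, zpow_add₀ (hw j), ← pow_mul, ← zpow_natCast]
    congr 2
    rw [Fin.val_rev]
    omega
  rw [h, Matrix.det_mul_row, Matrix.det_transpose, Matrix.det_projVandermonde]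
  simp [pairProd]

theorem det_sum_bool {n : ℕ} (A : Bool → Fin n → Fin n → F) :
    Matrix.det (Matrix.of fun i j => ∑ b, A b i j) =
      ∑ ε : Fin n → Bool, Matrix.det (Matrix.of fun i j => A (ε j) i j) := by
  simp only [Matrix.det_apply, Matrix.of_apply, Finset.prod_univ_sum, Finset.smul_sum,
    Fintype.piFinset_univ]
  exact Finset.sum_comm

theorem det_zpow_sub_zpow_neg {n : ℕ} {z : Fin n → F} (hz : IsGeneric z) (c : ℤ) :
    Matrix.det (Matrix.of fun i j : Fin n =>
        z j ^ (c + 2 * ((n : ℤ) - 1 - (i : ℕ))) - z j ^ (-(c + 2 * ((n : ℤ) - 1 - (i : ℕ))))) =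
      ∑ ε, (∏ j, boolSign F (ε j)) *
        ((∏ j, invertAt z ε j ^ c) *
          pairProd fun i j => invertAt z ε i ^ 2 - invertAt z ε j ^ 2) := by
  have h : (Matrix.of fun i j : Fin n =>
        z j ^ (c + 2 * ((n : ℤ) - 1 - (i : ℕ))) - z j ^ (-(c + 2 * ((n : ℤ) - 1 - (i : ℕ))))) =
      Matrix.of fun i j : Fin n => ∑ b, boolSign F b *
        (if b then z j else (z j)⁻¹) ^ (c + 2 * ((n : ℤ) - 1 - (i : ℕ))) := by
    ext i j
    simp [boolSign, sub_eq_add_neg]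
  rw [h, det_sum_bool fun b i j => boolSign F b *
    (if b then z j else (z j)⁻¹) ^ (c + 2 * ((n : ℤ) - 1 - (i : ℕ)))]
  refine Finset.sum_congr rfl fun ε _ => ?_
  rw [← det_zpow (hz.invertAt ε).ne_zero, ← Matrix.det_mul_row]
  rfl

/-- The Weyl denominator of type `B`. -/
def weylDenomB {n : ℕ} (z : Fin n → F) : F :=
  (∏ j, (z j - (z j)⁻¹)) * pairProd fun i j => z i ^ 2 + (z i ^ 2)⁻¹ - (z j ^ 2 + (z j ^ 2)⁻¹)

theorem weylDenomB_invertAt {n : ℕ} (z : Fin n → F) (ε : Fin n → Bool) :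
    (∏ j, boolSign F (ε j)) * weylDenomB (invertAt z ε) = weylDenomB z := by
  have h1 : ∀ j, invertAt z ε j ^ 2 + (invertAt z ε j ^ 2)⁻¹ = z j ^ 2 + (z j ^ 2)⁻¹ := by
    intro j
    unfold invertAt
    split_ifs
    · rfl
    · rw [inv_pow, inv_inv, add_comm]
  simp only [weylDenomB, h1]
  rw [← mul_assoc, ← Finset.prod_mul_distrib]
  congr 1
  refine Finset.prod_congr rfl fun j _ => ?_
  unfold invertAt boolSign
  split_ifs <;> simp

theorem IsGeneric.one_sub_ne_zero {n : ℕ} {z : Fin n → F} (hz : IsGeneric z) (i j : Fin n) :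
    1 - (z i ^ 2)⁻¹ * (z j ^ 2)⁻¹ ≠ 0 := by
  intro h
  apply hz.mul_ne_one i j
  rw [← _root_.inv_inj, mul_inv, inv_one, ← sub_eq_zero.1 h]

theorem IsGeneric.one_sub_inv_ne_zero {n : ℕ} {z : Fin n → F} (hz : IsGeneric z) (i : Fin n) :
    1 - (z i ^ 2)⁻¹ ≠ 0 := by
  intro h
  apply hz.sq_ne_one i
  rw [← _root_.inv_inj, inv_one, ← sub_eq_zero.1 h]

theorem weylDenomB_ne_zero {n : ℕ} {z : Fin n → F} (hz : IsGeneric z) : weylDenomB z ≠ 0 := by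
  refine mul_ne_zero (Finset.prod_ne_zero_iff.2 fun i _ => ?_) (pairProd_ne_zero fun i j hij => ?_)
  · have h : z i - (z i)⁻¹ = z i * (1 - (z i ^ 2)⁻¹) := by
      have := hz.ne_zero i
      field_simp
    rw [h]
    exact mul_ne_zero (hz.ne_zero i) (hz.one_sub_inv_ne_zero i)
  · have h : z i ^ 2 + (z i ^ 2)⁻¹ - (z j ^ 2 + (z j ^ 2)⁻¹) =
        (z i ^ 2 - z j ^ 2) * (1 - (z i ^ 2)⁻¹ * (z j ^ 2)⁻¹) := by
      have := hz.ne_zero i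
      have := hz.ne_zero j
      field_simp
      ring
    rw [h]
    exact mul_ne_zero (sub_ne_zero.2 (hz.sq_ne_sq i j hij.ne)) (hz.one_sub_ne_zero i j)

/-- The summand of the type `B` Littlewood identity. -/
def littlewoodFactor {n : ℕ} (w : Fin n → F) : F :=
  (∏ j, (1 - (w j ^ 2)⁻¹)⁻¹) * pairProd fun i j => (1 - (w i ^ 2)⁻¹ * (w j ^ 2)⁻¹)⁻¹

/-- The type `B` character of weight `(m/2)^n` as a sum over the sign group. -/
def littlewoodSum {n : ℕ} (m : ℤ) (z : Fin n → F) : F :=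
  ∑ ε, (∏ j, invertAt z ε j ^ m) * littlewoodFactor (invertAt z ε)

theorem prod_mul_pairProd_eq {n : ℕ} {w : Fin n → F} (hw : IsGeneric w) (m : ℤ) :
    (∏ j, w j ^ (m + 1)) * (pairProd fun i j => w i ^ 2 - w j ^ 2) =
      weylDenomB w * ((∏ j, w j ^ m) * littlewoodFactor w) := by
  unfold weylDenomB littlewoodFactor
  have e1 : ∏ j, w j ^ (m + 1) =
      (∏ j, (w j - (w j)⁻¹)) * (∏ j, w j ^ m) * ∏ j, (1 - (w j ^ 2)⁻¹)⁻¹ := by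
    rw [← Finset.prod_mul_distrib, ← Finset.prod_mul_distrib]
    refine Finset.prod_congr rfl fun j _ => ?_
    have h0 := hw.ne_zero j
    rw [eq_mul_inv_iff_mul_eq₀ (hw.one_sub_inv_ne_zero j), zpow_add_one₀ h0]
    field_simp
  have e2 : (pairProd fun i j => w i ^ 2 - w j ^ 2) =
      (pairProd fun i j => w i ^ 2 + (w i ^ 2)⁻¹ - (w j ^ 2 + (w j ^ 2)⁻¹)) *
        pairProd fun i j => (1 - (w i ^ 2)⁻¹ * (w j ^ 2)⁻¹)⁻¹ := by
    rw [← pairProd_mul]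
    refine pairProd_congr fun i j _ => ?_
    have hi := hw.ne_zero i
    have hj := hw.ne_zero j
    rw [eq_mul_inv_iff_mul_eq₀ (hw.one_sub_ne_zero i j)]
    field_simp
    ring
  rw [e1, e2]
  ring

theorem det_eq_weylDenomB_mul {n : ℕ} {z : Fin n → F} (hz : IsGeneric z) (m : ℤ) :
    Matrix.det (Matrix.of fun i j : Fin n => z j ^ (m + 1 + 2 * ((n : ℤ) - 1 - (i : ℕ))) -
      z j ^ (-(m + 1 + 2 * ((n : ℤ) - 1 - (i : ℕ))))) = weylDenomB z * littlewoodSum m z := by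
  rw [det_zpow_sub_zpow_neg hz, littlewoodSum, Finset.mul_sum]
  refine Finset.sum_congr rfl fun ε _ => ?_
  rw [prod_mul_pairProd_eq (hz.invertAt ε), ← mul_assoc, weylDenomB_invertAt]

theorem littlewoodSum_neg_one {n : ℕ} {z : Fin (n + 1) → F} (hz : IsGeneric z) :
    littlewoodSum (-1) z = 0 := by
  refine (mul_eq_zero.1 ?_).resolve_left (weylDenomB_ne_zero hz)
  rw [← det_eq_weylDenomB_mul hz]
  refine Matrix.det_eq_zero_of_row_eq_zero (Fin.last n) fun j => ?_
  simp

theorem invertAt_invertAt {n : ℕ} (z : Fin n → F) (ε δ : Fin n → Bool) :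
    invertAt (invertAt z ε) δ = invertAt z fun j => ε j == δ j := by
  ext j
  unfold invertAt
  cases hε : ε j <;> cases hδ : δ j <;> simp [hε, hδ]

theorem littlewoodSum_invertAt {n : ℕ} (m : ℤ) (z : Fin n → F) (ε : Fin n → Bool) :
    littlewoodSum m (invertAt z ε) = littlewoodSum m z := by
  unfold littlewoodSum
  simp only [invertAt_invertAt]
  refine Fintype.sum_equiv (Function.Involutive.toPerm (fun δ j => ε j == δ j) ?_) _ _ fun δ => rfl
  intro δ
  ext j
  cases h : ε j <;> simp [h]

theorem prod_mul_invertAt {n : ℕ} {z : Fin n → F} (hz : ∀ i, z i ≠ 0) (ε : Fin n → Bool) :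
    ∏ j, z j * invertAt z ε j = ∏ j ∈ Finset.univ.filter (fun j => ε j = true), z j ^ 2 := by
  rw [Finset.prod_filter]
  refine Finset.prod_congr rfl fun j _ => ?_
  have := hz j
  unfold invertAt
  split_ifs
  · rw [sq]
  · exact mul_inv_cancel₀ this

theorem pairProd_mul_littlewoodFactor_succAbove {n : ℕ} {z : Fin (n + 1) → F} (hz : IsGeneric z)
    (ε : Fin (n + 1) → Bool) (j : Fin (n + 1)) :
    (-1) ^ (j : ℕ) * ((pairProd fun a b => z (j.succAbove a) ^ 2 - z (j.succAbove b) ^ 2) *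
        littlewoodFactor (invertAt (fun i => z (j.succAbove i)) fun i => ε (j.succAbove i))) =
      ((pairProd fun a b => z a ^ 2 - z b ^ 2) * littlewoodFactor (invertAt z ε)) *
        ((1 - (invertAt z ε j ^ 2)⁻¹) * ∏ i, ((1 - (invertAt z ε j ^ 2)⁻¹ *
          (invertAt z ε (j.succAbove i) ^ 2)⁻¹) / (z j ^ 2 - z (j.succAbove i) ^ 2))) := by
  set w := invertAt z ε with hw
  have hwg : IsGeneric w := hz.invertAt ε
  have hw' : invertAt (fun i => z (j.succAbove i)) (fun i => ε (j.succAbove i)) =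
    fun i => w (j.succAbove i) := rfl
  have hanti := pairProd_succAbove
    (fun a b => (z a ^ 2 - z b ^ 2) * (1 - (w a ^ 2)⁻¹ * (w b ^ 2)⁻¹)⁻¹)
    (fun a b => by rw [mul_comm (w a ^ 2)⁻¹]; ring) j
  rw [hw', littlewoodFactor, littlewoodFactor]
  rw [pairProd_mul, pairProd_mul (fun a b => z (j.succAbove a) ^ 2 - z (j.succAbove b) ^ 2)] at hanti
  set A := pairProd fun a b => z a ^ 2 - z b ^ 2
  set B := pairProd fun a b => (1 - (w a ^ 2)⁻¹ * (w b ^ 2)⁻¹)⁻¹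
  set A' := pairProd fun a b => z (j.succAbove a) ^ 2 - z (j.succAbove b) ^ 2
  set B' := pairProd fun a b => (1 - (w (j.succAbove a) ^ 2)⁻¹ * (w (j.succAbove b) ^ 2)⁻¹)⁻¹
  rw [Fin.prod_univ_succAbove _ j]
  set P := ∏ i, (1 - (w (j.succAbove i) ^ 2)⁻¹)⁻¹
  have h1 : (1 - (w j ^ 2)⁻¹)⁻¹ * (1 - (w j ^ 2)⁻¹) = 1 :=
    inv_mul_cancel₀ (hwg.one_sub_inv_ne_zero j)
  have h2 : (∏ i, (z j ^ 2 - z (j.succAbove i) ^ 2) *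
        (1 - (w j ^ 2)⁻¹ * (w (j.succAbove i) ^ 2)⁻¹)⁻¹) *
      ∏ i, ((1 - (w j ^ 2)⁻¹ * (w (j.succAbove i) ^ 2)⁻¹) /
        (z j ^ 2 - z (j.succAbove i) ^ 2)) = 1 := by
    rw [← Finset.prod_mul_distrib]
    refine Finset.prod_eq_one fun i _ => ?_
    have e1 := hwg.one_sub_ne_zero j (j.succAbove i)
    have e2 := sub_ne_zero.2 (hz.sq_ne_sq j (j.succAbove i) (Fin.succAbove_ne j i).symm)
    rw [mul_assoc, inv_mul_eq_div, div_div_cancel_left' e1, mul_inv_cancel₀ e2]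
  linear_combination (-(P * (1 - (w j ^ 2)⁻¹)⁻¹ * (1 - (w j ^ 2)⁻¹) *
      ∏ i, ((1 - (w j ^ 2)⁻¹ * (w (j.succAbove i) ^ 2)⁻¹) / (z j ^ 2 - z (j.succAbove i) ^ 2)))) *
      hanti - P * (-1) ^ (j : ℕ) * (A' * B') * h2 - P * (-1) ^ (j : ℕ) * (A' * B') *
      ((∏ i, (z j ^ 2 - z (j.succAbove i) ^ 2) *
        (1 - (w j ^ 2)⁻¹ * (w (j.succAbove i) ^ 2)⁻¹)⁻¹) *
      ∏ i, ((1 - (w j ^ 2)⁻¹ * (w (j.succAbove i) ^ 2)⁻¹) /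
        (z j ^ 2 - z (j.succAbove i) ^ 2))) * h1

theorem weight_mul_prod_eq {n : ℕ} {z : Fin (n + 1) → F} (hz : IsGeneric z)
    (ε : Fin (n + 1) → Bool) (j : Fin (n + 1)) (hj : ε j = true) :
    z j ^ (2 * n) * (∏ i, z i * invertAt z ε i) *
        ((1 - (invertAt z ε j ^ 2)⁻¹) * ∏ i, ((1 - (invertAt z ε j ^ 2)⁻¹ *
          (invertAt z ε (j.succAbove i) ^ 2)⁻¹) / (z j ^ 2 - z (j.succAbove i) ^ 2))) =
      (z j ^ 2 - 1) * ∏ i ∈ (Finset.univ.filter (fun i => ε i = true)).erase j,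
        ((z i ^ 2 * z j ^ 2 - 1) / (z j ^ 2 - z i ^ 2)) := by
  have hwj : invertAt z ε j = z j := by simp [invertAt, hj]
  have hz0 := hz.ne_zero
  have hR : ∏ i ∈ (Finset.univ.filter (fun i => ε i = true)).erase j,
        ((z i ^ 2 * z j ^ 2 - 1) / (z j ^ 2 - z i ^ 2)) =
      ∏ i : Fin n, if ε (j.succAbove i) = true then
        (z (j.succAbove i) ^ 2 * z j ^ 2 - 1) / (z j ^ 2 - z (j.succAbove i) ^ 2) else 1 := by
    rw [← Finset.filter_ne', Finset.filter_filter, Finset.prod_filter,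
      Fin.prod_univ_succAbove _ j]
    simp [Fin.succAbove_ne]
  have hL : z j ^ (2 * n) = ∏ _i : Fin n, z j ^ 2 := by simp [pow_mul]
  rw [Fin.prod_univ_succAbove _ j, hR, hL, hwj]
  have h1 : z j * z j * (1 - (z j ^ 2)⁻¹) = z j ^ 2 - 1 := by
    have := hz0 j
    field_simp
  rw [← h1]
  have h2 : (∏ _i : Fin n, z j ^ 2) * (∏ i, z (j.succAbove i) * invertAt z ε (j.succAbove i)) *
      (∏ i, ((1 - (z j ^ 2)⁻¹ *
          (invertAt z ε (j.succAbove i) ^ 2)⁻¹) / (z j ^ 2 - z (j.succAbove i) ^ 2))) =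
      ∏ i : Fin n, if ε (j.succAbove i) = true then
        (z (j.succAbove i) ^ 2 * z j ^ 2 - 1) / (z j ^ 2 - z (j.succAbove i) ^ 2) else 1 := by
    rw [← Finset.prod_mul_distrib, ← Finset.prod_mul_distrib]
    refine Finset.prod_congr rfl fun i _ => ?_
    have e1 := hz0 j
    have e2 := hz0 (j.succAbove i)
    have e3 := sub_ne_zero.2 (hz.sq_ne_sq j (j.succAbove i) (Fin.succAbove_ne j i).symm)
    unfold invertAt
    split_ifs <;> field_simp
  rw [← h2]
  ring

theorem littlewood_summand_step {n : ℕ} {z : Fin (n + 1) → F} (hz : IsGeneric z) (m : ℤ)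
    (ε : Fin (n + 1) → Bool) :
    ∑ j ∈ Finset.univ.filter (fun j => ε j = true), (-1) ^ (j : ℕ) * z j ^ (2 * m + 2 * n) *
      ((pairProd fun a b => z (j.succAbove a) ^ 2 - z (j.succAbove b) ^ 2) *
        ((∏ i, z (j.succAbove i) ^ m) * ((∏ i, invertAt z ε (j.succAbove i) ^ m) *
          littlewoodFactor
            (invertAt (fun i => z (j.succAbove i)) fun i => ε (j.succAbove i))))) =
      (pairProd fun a b => z a ^ 2 - z b ^ 2) *
        ((∏ i, z i ^ m) * ((∏ i, invertAt z ε i ^ m) * littlewoodFactor (invertAt z ε))) -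
      (pairProd fun a b => z a ^ 2 - z b ^ 2) *
        ((∏ i, z i ^ (m - 1)) *
          ((∏ i, invertAt z ε i ^ (m - 1)) * littlewoodFactor (invertAt z ε))) := by
  set t := ∏ i, z i * invertAt z ε i with ht
  have ht0 : t ≠ 0 := Finset.prod_ne_zero_iff.2 fun i _ =>
    mul_ne_zero (hz.ne_zero i) ((hz.invertAt ε).ne_zero i)
  have hprod : ∀ c : ℤ, (∏ i, z i ^ c) * ∏ i, invertAt z ε i ^ c = t ^ c := fun c => by
    rw [← Finset.prod_mul_distrib, ht, ← Finset.prod_zpow]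
    exact Finset.prod_congr rfl fun i _ => (mul_zpow _ _ _).symm
  set Q := (pairProd fun a b => z a ^ 2 - z b ^ 2) * littlewoodFactor (invertAt z ε) with hQ
  have hterm : ∀ j ∈ Finset.univ.filter (fun j => ε j = true),
      (-1) ^ (j : ℕ) * z j ^ (2 * m + 2 * n) *
      ((pairProd fun a b => z (j.succAbove a) ^ 2 - z (j.succAbove b) ^ 2) *
        ((∏ i, z (j.succAbove i) ^ m) * ((∏ i, invertAt z ε (j.succAbove i) ^ m) *
          littlewoodFactor
            (invertAt (fun i => z (j.succAbove i)) fun i => ε (j.succAbove i))))) =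
      t ^ (m - 1) * Q * ((z j ^ 2 - 1) *
        ∏ i ∈ (Finset.univ.filter (fun i => ε i = true)).erase j,
          ((z i ^ 2 * z j ^ 2 - 1) / (z j ^ 2 - z i ^ 2))) := by
    intro j hj
    have hj : ε j = true := by simpa using hj
    have e1 := pairProd_mul_littlewoodFactor_succAbove hz ε j
    have e2 := weight_mul_prod_eq hz ε j hj
    have e3 : z j ^ (2 * m + 2 * n) * (∏ i, z (j.succAbove i) ^ m) *
        (∏ i, invertAt z ε (j.succAbove i) ^ m) = z j ^ (2 * n) * (t * t ^ (m - 1)) := by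
      rw [← zpow_one_add₀ ht0, add_sub_cancel, ← hprod, Fin.prod_univ_succAbove _ j,
        Fin.prod_univ_succAbove (fun i => invertAt z ε i ^ m) j, zpow_add₀ (hz.ne_zero j),
        two_mul m, zpow_add₀ (hz.ne_zero j)]
      have : invertAt z ε j = z j := by simp [invertAt, hj]
      rw [this]
      have : z j ^ (2 * (n : ℤ)) = z j ^ (2 * n) := by exact_mod_cast zpow_natCast (z j) (2 * n)
      rw [this]
      ring
    rw [← e2]
    rw [← hQ] at e1
    linear_combination (((-1) ^ (j : ℕ) *
      ((pairProd fun a b => z (j.succAbove a) ^ 2 - z (j.succAbove b) ^ 2) *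
        littlewoodFactor (invertAt (fun i => z (j.succAbove i)) fun i => ε (j.succAbove i)))) * e3) +
      z j ^ (2 * n) * (t * t ^ (m - 1)) * e1
  rw [Finset.sum_congr rfl hterm, ← Finset.mul_sum,
    sum_prod_mul_sub_one_div _ (fun i => z i ^ 2) ?_ (fun i _ => hz.sq_ne_neg_one i),
    ← prod_mul_invertAt hz.ne_zero, ← ht]
  · have h1 := hprod m
    have h2 := hprod (m - 1)
    have h3 : t ^ m = t ^ (m - 1) * t := by rw [← zpow_add_one₀ ht0, sub_add_cancel]
    rw [h3] at h1
    linear_combination (-Q) * h1 + Q * h2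
  · intro a _ b _ hab
    by_contra hne
    exact hz.sq_ne_sq a b hne hab

theorem littlewoodSum_step {n : ℕ} {z : Fin (n + 1) → F} (hz : IsGeneric z) (m : ℤ) :
    ∑ j : Fin (n + 1), (-1) ^ (j : ℕ) * z j ^ (2 * m + 2 * n) *
      ((pairProd fun a b => z (j.succAbove a) ^ 2 - z (j.succAbove b) ^ 2) *
        ((∏ i, z (j.succAbove i) ^ m) * littlewoodSum m fun i => z (j.succAbove i))) =
      (pairProd fun a b => z a ^ 2 - z b ^ 2) * ((∏ i, z i ^ m) * littlewoodSum m z) -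
      (pairProd fun a b => z a ^ 2 - z b ^ 2) *
        ((∏ i, z i ^ (m - 1)) * littlewoodSum (m - 1) z) := by
  simp only [littlewoodSum, Finset.mul_sum]
  rw [← Finset.sum_sub_distrib,
    Finset.sum_congr rfl fun ε _ => (littlewood_summand_step hz m ε).symm]
  simp only [Finset.sum_filter]
  symm
  rw [Finset.sum_comm]
  refine Finset.sum_congr rfl fun j _ => ?_
  rw [← (Fin.insertNthEquiv (fun _ => Bool) j).sum_comp, Fintype.sum_prod_type]
  simp [Fin.insertNthEquiv, invertAt]

/-- The bounded Littlewood identity, in terms of bialternants. -/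
theorem sum_boundedPartitions_det (n M : ℕ) {z : Fin n → F} (hz : IsGeneric z) :
    ∑ p ∈ boundedPartitions n M,
      Matrix.det (Matrix.of fun i j : Fin n =>
        z j ^ (2 * (p i : ℤ) + 2 * ((n : ℤ) - 1 - (i : ℕ)))) =
      (pairProd fun a b => z a ^ 2 - z b ^ 2) *
        ((∏ i, z i ^ ((M : ℤ) - 1)) * littlewoodSum ((M : ℤ) - 1) z) := by
  induction n generalizing M with
  | zero =>
    have : boundedPartitions 0 M = Finset.univ := by
      ext p
      simpa [mem_boundedPartitions, Subsingleton.antitone] using Subsingleton.elim _ _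
    rw [this, Fintype.sum_unique]
    simp [pairProd, littlewoodSum, littlewoodFactor]
  | succ n ihn =>
    induction M with
    | zero =>
      have : boundedPartitions (n + 1) 0 = ∅ := by
        ext p
        simp [mem_boundedPartitions]
      simp [this, littlewoodSum_neg_one hz]
    | succ M ihM =>
      rw [sum_boundedPartitions_succ, ihM]
      have hdet : ∀ p : Fin n → ℕ, Matrix.det (Matrix.of fun i j : Fin (n + 1) =>
          z j ^ (2 * (((Fin.cons M p : Fin (n + 1) → ℕ) i : ℕ) : ℤ) +
            2 * (((n + 1 : ℕ) : ℤ) - 1 - (i : ℕ)))) =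
          ∑ j : Fin (n + 1), (-1) ^ (j : ℕ) * z j ^ (2 * (M : ℤ) + 2 * n) *
            Matrix.det (Matrix.of fun i l : Fin n =>
              z (j.succAbove l) ^ (2 * (p i : ℤ) + 2 * ((n : ℤ) - 1 - (i : ℕ)))) := by
        intro p
        rw [Matrix.det_succ_row_zero]
        refine Finset.sum_congr rfl fun j _ => ?_
        congr 2
        · simp
        · ext i l
          simp only [Matrix.submatrix_apply, Matrix.of_apply, Fin.cons_succ, Fin.val_succ]
          congr 1
          push_cast
          ring
      simp only [hdet]
      rw [Finset.sum_comm]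
      have hstep := littlewoodSum_step hz M
      simp only [← Finset.mul_sum]
      have := fun j : Fin (n + 1) => ihn (M + 1) (hz.comp (Fin.succAbove_right_injective (p := j)))
      push_cast at this
      simp only [add_sub_cancel_right] at this
      simp only [this]
      rw [hstep]
      push_cast
      rw [add_sub_cancel_right]
      ring

theorem littlewoodSum_zero {n : ℕ} {z : Fin n → F} (hz : IsGeneric z) :
    littlewoodSum 0 z = 1 := by
  have h := sum_boundedPartitions_det n 1 hz
  have hb : boundedPartitions n 1 = {fun _ => 0} := by
    ext p
    simp only [mem_boundedPartitions, Nat.lt_one_iff, Finset.mem_singleton, funext_iff]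
    exact ⟨fun h => h.1, fun h => ⟨h, fun i j _ => by simp [h]⟩⟩
  have hd := det_zpow hz.ne_zero 0
  have hp : (pairProd fun a b => z a ^ 2 - z b ^ 2) ≠ 0 :=
    pairProd_ne_zero fun i j hij => sub_ne_zero.2 (hz.sq_ne_sq i j hij.ne)
  rw [hb, Finset.sum_singleton] at h
  simp only [Nat.cast_zero, mul_zero, Nat.cast_one, sub_self, zpow_zero, Finset.prod_const_one,
    one_mul] at h hd
  rw [hd] at h
  exact (mul_eq_left₀ hp).1 h.symm

theorem soBD_const {n : ℕ} {z : Fin n → F} (hz : IsGeneric z) (m : ℤ) :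
    soBD z (fun _ => m) = littlewoodSum m z := by
  have e : ∀ c d : ℤ, c = d → ∀ x : F, x ^ c - x ^ (-c) = x ^ d - x ^ (-d) := by
    rintro c _ rfl x
    rfl
  have e1 : (Matrix.of fun i j : Fin n =>
      z j ^ (m + 2 * ((n : ℤ) - (i : ℕ)) - 1) - z j ^ (-(m + 2 * ((n : ℤ) - (i : ℕ)) - 1))) =
      Matrix.of fun i j : Fin n => z j ^ (m + 1 + 2 * ((n : ℤ) - 1 - (i : ℕ))) -
        z j ^ (-(m + 1 + 2 * ((n : ℤ) - 1 - (i : ℕ)))) := by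
    ext i j
    exact e _ _ (by ring) _
  have e0 : (Matrix.of fun i j : Fin n =>
      z j ^ (2 * ((n : ℤ) - (i : ℕ)) - 1) - z j ^ (-(2 * ((n : ℤ) - (i : ℕ)) - 1))) =
      Matrix.of fun i j : Fin n => z j ^ ((0 : ℤ) + 1 + 2 * ((n : ℤ) - 1 - (i : ℕ))) -
        z j ^ (-((0 : ℤ) + 1 + 2 * ((n : ℤ) - 1 - (i : ℕ)))) := by
    ext i j
    exact e _ _ (by ring) _
  rw [soBD, e1, e0, det_eq_weylDenomB_mul hz, det_eq_weylDenomB_mul hz, littlewoodSum_zero hz,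
    mul_one, mul_div_cancel_left₀ _ (weylDenomB_ne_zero hz)]

/-- The coefficient of the power of `z j` (if `b`) or of its inverse (if not) in the `j`-th column
of the matrix `interMatD k z μ`. -/
def interCoeff {N : ℕ} (k : ℕ) (z : Fin N → F) (b : Bool) (j : Fin N) : F :=
  if (j : ℕ) < k then
    boolSign F b * (if b then z j else (z j)⁻¹) ^ (2 * ((k : ℤ) - N + 1)) /
      ∏ l ∈ Finset.univ.filter (fun l : Fin N => k ≤ (l : ℕ)),
        (1 - ((if b then z j else (z j)⁻¹) ^ 2)⁻¹ * z l ^ 2)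
  else if b then 1 else 0

theorem det_interMatD {N : ℕ} (k : ℕ) {z : Fin N → F} (hz : ∀ i, z i ≠ 0) (μ : Fin N → ℤ) :
    (interMatD k z μ).det = ∑ ε, (∏ j, interCoeff k z (ε j) j) *
      Matrix.det (Matrix.of fun i j : Fin N =>
        invertAt z ε j ^ (μ i + 2 * ((N : ℤ) - 1 - (i : ℕ)))) := by
  have h : interMatD k z μ = Matrix.of fun i j : Fin N => ∑ b, interCoeff k z b j *
        (if b then z j else (z j)⁻¹) ^ (μ i + 2 * ((N : ℤ) - 1 - (i : ℕ))) := by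
    ext i j
    have hj := hz j
    have hexp : μ i + 2 * ((k : ℤ) - (i : ℕ)) =
      2 * ((k : ℤ) - N + 1) + (μ i + 2 * ((N : ℤ) - 1 - (i : ℕ))) := by ring
    rw [interMatD, Matrix.of_apply, Matrix.of_apply, Fintype.sum_bool]
    by_cases hjk : (j : ℕ) < k
    · simp only [interCoeff, boolSign, if_pos hjk, if_true, Bool.false_eq_true, if_false]
      rw [hexp, ← _root_.inv_zpow', zpow_add₀ hj (2 * ((k : ℤ) - N + 1)),
        zpow_add₀ (inv_ne_zero hj) (2 * ((k : ℤ) - N + 1)), inv_pow, inv_inv]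
      ring
    · simp [interCoeff, hjk]
  rw [h, det_sum_bool fun b i j => interCoeff k z b j *
    (if b then z j else (z j)⁻¹) ^ (μ i + 2 * ((N : ℤ) - 1 - (i : ℕ)))]
  refine Finset.sum_congr rfl fun ε _ => ?_
  rw [← Matrix.det_mul_row]
  rfl

theorem sum_det_interMatD {N : ℕ} (k m : ℕ) {z : Fin N → F} (hz : IsGeneric z) (a : ℤ) :
    ∑ p ∈ boundedPartitions N (m + 1), (interMatD k z fun i => 2 * (p i : ℤ) + a).det =
      littlewoodSum m z * (interMatD k z fun _ => (m : ℤ) + a).det := by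
  simp only [det_interMatD k hz.ne_zero]
  rw [Finset.sum_comm, Finset.mul_sum]
  refine Finset.sum_congr rfl fun ε _ => ?_
  have hw := hz.invertAt ε
  set w := invertAt z ε with hwdef
  have h1 : ∀ p : Fin N → ℕ, Matrix.det (Matrix.of fun i j : Fin N =>
        w j ^ (2 * (p i : ℤ) + a + 2 * ((N : ℤ) - 1 - (i : ℕ)))) = (∏ j, w j ^ a) *
      Matrix.det (Matrix.of fun i j : Fin N =>
        w j ^ (2 * (p i : ℤ) + 2 * ((N : ℤ) - 1 - (i : ℕ)))) := by
    intro p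
    rw [← Matrix.det_mul_row]
    congr 1
    ext i j
    rw [Matrix.of_apply, Matrix.of_apply, Matrix.of_apply, ← zpow_add₀ (hw.ne_zero j)]
    congr 1
    ring
  have h2 := sum_boundedPartitions_det N (m + 1) hw
  push_cast at h2
  rw [add_sub_cancel_right, hwdef, littlewoodSum_invertAt, ← hwdef] at h2
  have h3 : ∏ j, w j ^ ((m : ℤ) + a) = (∏ j, w j ^ (m : ℤ)) * ∏ j, w j ^ a := by
    rw [← Finset.prod_mul_distrib]
    exact Finset.prod_congr rfl fun j _ => zpow_add₀ (hw.ne_zero j) _ _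
  simp only [h1]
  rw [← Finset.mul_sum, ← Finset.mul_sum, h2, det_zpow hw.ne_zero, h3]
  ring

theorem prod_filter_le_eq {k r : ℕ} (f : Fin (k + r) → F) :
    ∏ l ∈ Finset.univ.filter (fun l : Fin (k + r) => k ≤ (l : ℕ)), f l =
      ∏ l : Fin r, f (Fin.natAdd k l) := by
  have h : ∀ x : Fin k, ¬ k ≤ (x : ℕ) := fun x => by omega
  rw [Finset.prod_filter, Fin.prod_univ_add]
  simp [h]

/-- For rectangular weights the intermediate bialternant factors. -/
theorem det_interMatD_const {k r : ℕ} {z : Fin (k + r) → F} (hz : IsGeneric z) (c : ℤ) :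
    (interMatD k z fun _ => c).det =
      (pairProd fun i j : Fin r => z (Fin.natAdd k i) ^ 2 - z (Fin.natAdd k j) ^ 2) *
        (∏ l : Fin r, z (Fin.natAdd k l) ^ c) *
        Matrix.det (Matrix.of fun i j : Fin k =>
          z (Fin.castAdd r j) ^ (c + 2 * ((k : ℤ) - (i : ℕ))) -
            z (Fin.castAdd r j) ^ (-(c + 2 * ((k : ℤ) - (i : ℕ))))) := by
  have hzk : IsGeneric fun j : Fin k => z (Fin.castAdd r j) :=
    hz.comp (Fin.castAdd_injective k r)
  have hexp : (Matrix.of fun i j : Fin k =>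
          z (Fin.castAdd r j) ^ (c + 2 * ((k : ℤ) - (i : ℕ))) -
            z (Fin.castAdd r j) ^ (-(c + 2 * ((k : ℤ) - (i : ℕ))))) =
      Matrix.of fun i j : Fin k =>
          z (Fin.castAdd r j) ^ (c + 2 + 2 * ((k : ℤ) - 1 - (i : ℕ))) -
            z (Fin.castAdd r j) ^ (-(c + 2 + 2 * ((k : ℤ) - 1 - (i : ℕ)))) := by
    ext i j
    rw [Matrix.of_apply, Matrix.of_apply]
    ring_nf
  rw [hexp, det_zpow_sub_zpow_neg hzk, det_interMatD k hz.ne_zero,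
    ← (Fin.appendEquiv k r).sum_comp, Fintype.sum_prod_type, Finset.mul_sum]
  refine Finset.sum_congr rfl fun a _ => ?_
  rw [Fintype.sum_eq_single fun _ => true]
  · set ε : Fin (k + r) → Bool := Fin.appendEquiv k r (a, fun _ => true) with hε
    have hl : ∀ i : Fin k, ε (Fin.castAdd r i) = a i := fun i => Fin.append_left _ _ i
    have hr : ∀ l : Fin r, ε (Fin.natAdd k l) = true := fun l => Fin.append_right _ _ l
    have hw := hz.invertAt ε
    have hwl : ∀ i : Fin k, invertAt z ε (Fin.castAdd r i) =
        invertAt (fun j : Fin k => z (Fin.castAdd r j)) a i := fun i => by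
      simp [invertAt, hl]
    have hwr : ∀ l : Fin r, invertAt z ε (Fin.natAdd k l) = z (Fin.natAdd k l) := fun l => by
      simp [invertAt, hr]
    rw [det_zpow hw.ne_zero, pairProd_sub_add fun i => invertAt z ε i ^ 2]
    simp only [Fin.prod_univ_add, hwl, hwr, hl, hr]
    set w := invertAt (fun j : Fin k => z (Fin.castAdd r j)) a with hwdef
    have hw0 : ∀ i, w i ≠ 0 := (hzk.invertAt a).ne_zero
    have hcr : ∏ l : Fin r, interCoeff k z true (Fin.natAdd k l) = 1 :=
      Finset.prod_eq_one fun l _ => by simp [interCoeff]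
    have hcl : (∏ i : Fin k, interCoeff k z (a i) (Fin.castAdd r i)) *
        (∏ i : Fin k, w i ^ c) * (∏ i, ∏ l, (w i ^ 2 - z (Fin.natAdd k l) ^ 2)) =
        (∏ i, boolSign F (a i)) * ∏ i, w i ^ (c + 2) := by
      rw [← Finset.prod_mul_distrib, ← Finset.prod_mul_distrib, ← Finset.prod_mul_distrib]
      refine Finset.prod_congr rfl fun i _ => ?_
      have hlt : ((Fin.castAdd r i : Fin (k + r)) : ℕ) < k := i.isLt
      have hi : (if a i = true then z (Fin.castAdd r i) else (z (Fin.castAdd r i))⁻¹) = w i := rfl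
      rw [interCoeff, if_pos hlt, hi, prod_filter_le_eq]
      have hne : ∀ l : Fin r, 1 - (w i ^ 2)⁻¹ * z (Fin.natAdd k l) ^ 2 ≠ 0 := by
        intro l h
        have h2 := hw.sq_ne_sq (Fin.castAdd r i) (Fin.natAdd k l)
          (by simp only [Ne, Fin.ext_iff, Fin.val_castAdd, Fin.val_natAdd]; omega)
        rw [hwl, hwr] at h2
        rw [sub_eq_zero, eq_comm, inv_mul_eq_one₀ (pow_ne_zero 2 (hw0 i))] at h
        exact h2 h
      have hfac : ∏ l : Fin r, (w i ^ 2 - z (Fin.natAdd k l) ^ 2) =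
          w i ^ (2 * r) * ∏ l : Fin r, (1 - (w i ^ 2)⁻¹ * z (Fin.natAdd k l) ^ 2) := by
        have : w i ^ (2 * r) = ∏ _l : Fin r, w i ^ 2 := by simp [pow_mul]
        rw [this, ← Finset.prod_mul_distrib]
        refine Finset.prod_congr rfl fun l _ => ?_
        have := hw0 i
        field_simp
      have hpow : w i ^ (c + 2) =
          w i ^ (2 * ((k : ℤ) - ((k + r : ℕ) : ℤ) + 1)) * w i ^ c * w i ^ (2 * r) := by
        rw [← zpow_natCast (w i) (2 * r), ← zpow_add₀ (hw0 i), ← zpow_add₀ (hw0 i)]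
        congr 1
        push_cast
        ring
      have hP : ∏ l : Fin r, (1 - (w i ^ 2)⁻¹ * z (Fin.natAdd k l) ^ 2) ≠ 0 :=
        Finset.prod_ne_zero_iff.2 fun l _ => hne l
      rw [hfac, hpow]
      set P := ∏ l : Fin r, (1 - (w i ^ 2)⁻¹ * z (Fin.natAdd k l) ^ 2)
      rw [div_mul_eq_mul_div, div_mul_eq_mul_div, div_eq_iff hP]
      ring
    rw [hcr]
    linear_combination ((pairProd fun i j => w i ^ 2 - w j ^ 2) *
      (∏ l : Fin r, z (Fin.natAdd k l) ^ c) *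
      pairProd fun i j : Fin r => z (Fin.natAdd k i) ^ 2 - z (Fin.natAdd k j) ^ 2) * hcl
  · intro b hb
    obtain ⟨l, hl⟩ : ∃ l, b l = false := by
      by_contra! h
      exact hb (funext fun l => by simpa using h l)
    refine mul_eq_zero_of_left (Finset.prod_eq_zero (Finset.mem_univ (Fin.natAdd k l)) ?_) _
    have : Fin.appendEquiv k r (a, b) (Fin.natAdd k l) = false :=
      (Fin.append_right _ _ l).trans hl
    rw [this]
    simp [interCoeff]

theorem isGeneric_gen (n : ℕ) : IsGeneric (gen n) := by
  have hinj := IsFractionRing.injective (MvPolynomial (Fin n) ℚ) (FF n)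
  refine ⟨fun i h => ?_, fun i j h => ?_, fun i j hij h => ?_⟩
  · exact MvPolynomial.X_ne_zero i (hinj (h.trans (map_zero _).symm))
  · unfold gen at h
    rw [← map_pow, ← map_pow, ← map_mul] at h
    have := congrArg (MvPolynomial.eval fun _ => (0 : ℚ)) (hinj (h.trans (map_one _).symm))
    simp at this
  · unfold gen at h
    rw [← map_pow, ← map_pow] at h
    have := congrArg (MvPolynomial.eval (Pi.single i (1 : ℚ))) (hinj h)
    simp [Pi.single_eq_of_ne hij.symm] at this

/-- The identity for arbitrary generic values of the (square roots of the) variables. -/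
theorem sum_spInterD_of_isGeneric (k r m : ℕ) (a : ℤ) {z : Fin (k + r) → F} (hz : IsGeneric z) :
    ∑ p ∈ boundedPartitions (k + r) (m + 1), spInterD k z (fun i => 2 * (p i : ℤ) + a) =
      soBD z (fun _ => (m : ℤ)) *
        spD (fun i : Fin k => z (Fin.castAdd r i)) (fun _ => (m : ℤ) + a) *
        ∏ l : Fin r, z (Fin.natAdd k l) ^ ((m : ℤ) + a) := by
  have hX : (pairProd fun i j : Fin r => z (Fin.natAdd k i) ^ 2 - z (Fin.natAdd k j) ^ 2) ≠ 0 :=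
    pairProd_ne_zero fun i j hij => sub_ne_zero.2
      ((hz.comp (Fin.natAdd_injective r k)).sq_ne_sq i j hij.ne)
  simp only [spInterD]
  rw [← Finset.sum_div, sum_det_interMatD k m hz, soBD_const hz, det_interMatD_const hz,
    det_interMatD_const hz, spD]
  simp only [zpow_zero, Finset.prod_const_one, mul_one, zero_add]
  rw [mul_assoc (pairProd _), mul_left_comm, mul_div_mul_left _ _ hX]
  ring

/-- **Theorem (main theorem, part (1)).**  For `1 ≤ n`, `0 ≤ k ≤ n`, `m` a positive integer and
`a = a2/2` a nonnegative half-integer, the sum of the intermediate symplectic characters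
`sp^{(k,n-k)}_{λ+(a^n)}(x_1,…,x_k | x_{k+1},…,x_n)` over all partitions `λ ⊆ (m^n)` equals
`so^B_{((m/2)^n)}(x_1,…,x_n) · sp_{((m/2+a)^k)}(x_1,…,x_k) · (x_{k+1} ⋯ x_n)^{m/2+a}`,
as an identity in `ℚ(x_1^{1/2}, …, x_n^{1/2})`.  Here `gen n i` plays the role of `x_i^{1/2}`,
and all weights are doubled. -/
theorem sum_spInter_rectangle (n k m : ℕ) (a2 : ℤ) (hn : 1 ≤ n) (hk : k ≤ n)
    (hm : 0 < m) (ha : 0 ≤ a2) :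
    ∑ lam ∈ Finset.univ.filter
        (fun lam : Fin n → Fin (m + 1) => Antitone fun i => (lam i : ℕ)),
      spInterD k (gen n) (fun i => 2 * ((lam i : ℕ) : ℤ) + a2) =
    soBD (gen n) (fun _ => (m : ℤ)) *
      spD (fun i : Fin k => gen n (Fin.castLE hk i)) (fun _ => (m : ℤ) + a2) *
      ∏ i ∈ Finset.univ.filter (fun i : Fin n => k ≤ (i : ℕ)), gen n i ^ ((m : ℤ) + a2) := by
  obtain ⟨r, rfl⟩ := Nat.exists_eq_add_of_le hk
  rw [← sum_boundedPartitions_eq_sum_fin (k + r) (m + 1)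
    fun p => spInterD k (gen (k + r)) fun i => 2 * (p i : ℤ) + a2,
    sum_spInterD_of_isGeneric k r m a2 (isGeneric_gen _), prod_filter_le_eq]
  rfl
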